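/- arXiv:nlin/0603028 — 3 statements merged into one kernel-verified Lean document; each statement's English description precedes it below -/
import Mathlib

section
/- For each site k, the cyclic L-operator is intertwined by the twisted six-vertex R-matrix at a root of unity: for all λ, ν ∈ ℂ one has the identity of 4×4 matrices over End(ℂ^{ZMod N}): R(λ,ν)·L^{(1)}(λ)·L^{(2)}(ν) = L^{(2)}(ν)·L^{(1)}(λ)·R(λ,ν), where L^{(1)}(λ) = L(λ) ⊗ I₂ and L^{(2)}(ν) = I₂ ⊗ L(ν) are Kronecker products in the two 2-dimensional auxiliary spaces (entries (L⊗I)_{(i,i'),(j,j')} = L_{ij}δ_{i',j'}, (I⊗L)_{(i,i'),(j,j')} = δ_{i,j}L_{i'j'}). -/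
open scoped BigOperators

noncomputable section

/-- Weyl operator `u` on the single-site space `ℂ^{ZMod N}`:  `u|γ⟩ = ω^γ|γ⟩`. -/
def U1 (N : ℕ) (ω : ℂ) : Module.End ℂ (ZMod N → ℂ) where
  toFun f := fun γ => ω ^ γ.val * f γ
  map_add' f g := by funext γ; simp [mul_add]
  map_smul' r f := by
    funext γ
    simp only [Pi.smul_apply, smul_eq_mul, RingHom.id_apply]
    ring

/-- Weyl operator `u⁻¹` on the single-site space: `u⁻¹|γ⟩ = ω^{−γ}|γ⟩`. -/
def U1inv (N : ℕ) (ω : ℂ) : Module.End ℂ (ZMod N → ℂ) where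
  toFun f := fun γ => ω ^ (-γ).val * f γ
  map_add' f g := by funext γ; simp [mul_add]
  map_smul' r f := by
    funext γ
    simp only [Pi.smul_apply, smul_eq_mul, RingHom.id_apply]
    ring

/-- Weyl operator `v` on the single-site space: `v|γ⟩ = |γ+1⟩`. -/
def V1 (N : ℕ) : Module.End ℂ (ZMod N → ℂ) where
  toFun f := fun γ => f (γ - 1)
  map_add' f g := rfl
  map_smul' r f := rfl

/-- The cyclic L-operator on the single-site space, a `2×2` matrix over `End(ℂ^{ZMod N})`. -/
def L1 (N : ℕ) (ω a b c d κ lam : ℂ) :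
    Matrix (Fin 2) (Fin 2) (Module.End ℂ (ZMod N → ℂ)) :=
  !![1 + (lam * κ) • V1 N,
     lam • (U1inv N ω * (a • (1 : Module.End ℂ (ZMod N → ℂ)) - b • V1 N));
     U1 N ω * (c • (1 : Module.End ℂ (ZMod N → ℂ)) - d • V1 N),
     (lam * a * c) • (1 : Module.End ℂ (ZMod N → ℂ)) + (b * d / κ) • V1 N]

/-- The twisted six-vertex R-matrix, a `4×4` scalar matrix with rows and columns indexed by
`Fin 2 × Fin 2` (ordered `(0,0),(0,1),(1,0),(1,1)`). -/
def Rmat (ω lam nu : ℂ) : Matrix (Fin 2 × Fin 2) (Fin 2 × Fin 2) ℂ :=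
  fun p q =>
    if p = q then
      if p.1 = p.2 then lam - ω * nu
      else if p.1 = 0 then ω * (lam - nu) else lam - nu
    else if p.1 = q.2 ∧ p.2 = q.1 ∧ p.1 ≠ p.2 then
      if p.1 = 0 then lam * (1 - ω) else nu * (1 - ω)
    else 0

/-- Kronecker product with the identity in the second auxiliary space:
`(L ⊗ I)_{(i,i'),(j,j')} = L_{ij} δ_{i',j'}`. -/
def kronFst {R : Type*} [Zero R] (M : Matrix (Fin 2) (Fin 2) R) :
    Matrix (Fin 2 × Fin 2) (Fin 2 × Fin 2) R :=
  fun p q => if p.2 = q.2 then M p.1 q.1 else 0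

/-- Kronecker product with the identity in the first auxiliary space:
`(I ⊗ L)_{(i,i'),(j,j')} = δ_{i,j} L_{i'j'}`. -/
def kronSnd {R : Type*} [Zero R] (M : Matrix (Fin 2) (Fin 2) R) :
    Matrix (Fin 2 × Fin 2) (Fin 2 × Fin 2) R :=
  fun p q => if p.1 = q.1 then M p.2 q.2 else 0

lemma pow_zmod_val_add {N : ℕ} [NeZero N] {ω : ℂ} (h : ω ^ N = 1) (x y : ZMod N) :
    ω ^ (x + y).val = ω ^ x.val * ω ^ y.val := by
  rw [ZMod.val_add, ← pow_add, pow_eq_pow_mod (x.val + y.val) h]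

lemma pow_zmod_val_sub_one {N : ℕ} [NeZero N] {ω : ℂ} (h : ω ^ N = 1) (hN : 2 ≤ N)
    (x : ZMod N) : ω ^ (x - 1).val = ω ^ x.val * ω⁻¹ := by
  have hω : ω ≠ 0 := fun h0 => by simp [h0, NeZero.ne N] at h
  have : Fact (1 < N) := ⟨hN⟩
  have h1 := pow_zmod_val_add h (x - 1) 1
  rw [sub_add_cancel, ZMod.val_one, pow_one] at h1
  rw [h1, mul_inv_cancel_right₀ hω]

lemma U1_apply (N : ℕ) (ω : ℂ) (f : ZMod N → ℂ) (x : ZMod N) :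
    U1 N ω f x = ω ^ x.val * f x := rfl

lemma U1inv_apply {N : ℕ} [NeZero N] {ω : ℂ} (h : ω ^ N = 1) (f : ZMod N → ℂ) (x : ZMod N) :
    U1inv N ω f x = (ω ^ x.val)⁻¹ * f x := by
  have h1 : ω ^ (-x).val = (ω ^ x.val)⁻¹ :=
    eq_inv_of_mul_eq_one_left (by rw [← pow_zmod_val_add h]; simp)
  rw [← h1]
  rfl

lemma V1_apply (N : ℕ) (f : ZMod N → ℂ) (x : ZMod N) : V1 N f x = f (x - 1) := rfl

set_option maxHeartbeats 4000000 in
/-- The cyclic L-operator is intertwined by the twisted six-vertex R-matrix at a root of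
unity:  `R(λ,ν)·L⁽¹⁾(λ)·L⁽²⁾(ν) = L⁽²⁾(ν)·L⁽¹⁾(λ)·R(λ,ν)` as `4×4` matrices over
`End(ℂ^{ZMod N})`, where `L⁽¹⁾(λ) = L(λ) ⊗ I₂` and `L⁽²⁾(ν) = I₂ ⊗ L(ν)`. -/
theorem bbs_RLL_relation
    (N : ℕ) (hN : 2 ≤ N)
    (ω : ℂ) (hω : ω = Complex.exp (2 * Real.pi * Complex.I / N))
    (a b c d κ : ℂ) (hκ : κ ≠ 0) (lam nu : ℂ) :
    (Rmat ω lam nu).map (fun r => r • (1 : Module.End ℂ (ZMod N → ℂ))) *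
        kronFst (L1 N ω a b c d κ lam) * kronSnd (L1 N ω a b c d κ nu) =
      kronSnd (L1 N ω a b c d κ nu) * kronFst (L1 N ω a b c d κ lam) *
        (Rmat ω lam nu).map (fun r => r • (1 : Module.End ℂ (ZMod N → ℂ))) := by
  have hN0 : N ≠ 0 := by omega
  have : NeZero N := ⟨hN0⟩
  have hωN : ω ^ N = 1 := hω ▸ (Complex.isPrimitiveRoot_exp N hN0).pow_eq_one
  have hω0 : ω ≠ 0 := hω ▸ Complex.exp_ne_zero _
  ext ⟨i, i'⟩ ⟨j, j'⟩ : 1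
  refine LinearMap.ext fun f => funext fun x => ?_
  have hx : ω ^ x.val ≠ 0 := pow_ne_zero _ hω0
  fin_cases i <;> fin_cases i' <;> fin_cases j <;> fin_cases j' <;>
    simp [Matrix.mul_apply, Fintype.sum_prod_type, Rmat, kronFst, kronSnd, L1, U1_apply,
      U1inv_apply hωN, V1_apply, pow_zmod_val_sub_one hωN hN, -mul_eq_mul_left_iff,
      -mul_eq_mul_right_iff] <;>
    generalize ω ^ x.val = z at * <;>
    field_simp <;> ring
end
end

section
/- The transfer matrices of the Baxter–Bazhanov–Stroganov model commute at different values of the spectral parameter: for all λ, μ ∈ ℂ, t_n(λ) ∘ t_n(μ) = t_n(μ) ∘ t_n(λ) as operators on V^(n). -/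
open scoped BigOperators

noncomputable section

/-- The `n`-site quantum space of the Baxter–Bazhanov–Stroganov model:
functions `(Fin n → ZMod N) → ℂ`. -/
abbrev BBSV (N n : ℕ) : Type := (Fin n → ZMod N) → ℂ

/-- Weyl operator `u_k`, acting diagonally by `ω^{γ_k}` on the basis vector `|γ⟩`. -/
def Uop (N : ℕ) (ω : ℂ) {n : ℕ} (k : Fin n) : Module.End ℂ (BBSV N n) where
  toFun f := fun γ => ω ^ (γ k).val * f γ
  map_add' f g := by funext γ; simp [mul_add]
  map_smul' r f := by
    funext γ
    simp only [Pi.smul_apply, smul_eq_mul, RingHom.id_apply]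
    ring

/-- Weyl operator `u_k⁻¹`, acting diagonally by `ω^{-γ_k}` on the basis vector `|γ⟩`. -/
def Uinv (N : ℕ) (ω : ℂ) {n : ℕ} (k : Fin n) : Module.End ℂ (BBSV N n) where
  toFun f := fun γ => ω ^ (-(γ k)).val * f γ
  map_add' f g := by funext γ; simp [mul_add]
  map_smul' r f := by
    funext γ
    simp only [Pi.smul_apply, smul_eq_mul, RingHom.id_apply]
    ring

/-- Weyl operator `v_k`, mapping `|γ⟩` to `|γ + e_k⟩`. -/
def Vop (N : ℕ) {n : ℕ} (k : Fin n) : Module.End ℂ (BBSV N n) where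
  toFun f := fun γ => f (fun j => γ j - if j = k then 1 else 0)
  map_add' f g := rfl
  map_smul' r f := rfl

/-- The cyclic L-operator at site `k` with parameters `A B C D K`, a `2×2` matrix over
`End(V^(n))`. -/
def Lop (N : ℕ) (ω : ℂ) {n : ℕ} (A B C D K : ℂ) (k : Fin n) (lam : ℂ) :
    Matrix (Fin 2) (Fin 2) (Module.End ℂ (BBSV N n)) :=
  !![1 + (lam * K) • Vop N k,
     lam • (Uinv N ω k * (A • (1 : Module.End ℂ (BBSV N n)) - B • Vop N k));
     Uop N ω k * (C • (1 : Module.End ℂ (BBSV N n)) - D • Vop N k),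
     (lam * A * C) • (1 : Module.End ℂ (BBSV N n)) + (B * D / K) • Vop N k]

/-- The monodromy matrix `T_n(λ) = L_1(λ) ⋯ L_n(λ)` (sites `1,…,n` are indexed by
`0,…,n-1`, the parameters being functions on `ℕ`). -/
def Tmat (N : ℕ) (ω : ℂ) (a b c d κ : ℕ → ℂ) (n : ℕ) (lam : ℂ) :
    Matrix (Fin 2) (Fin 2) (Module.End ℂ (BBSV N n)) :=
  ((List.finRange n).map
    (fun k => Lop N ω (a k.val) (b k.val) (c k.val) (d k.val) (κ k.val) k lam)).prod

section RMatrix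

variable {𝒜 : Type*} [Ring 𝒜]

/-- The embedding `T ↦ T ⊗ 1`. -/
def firstLeg : Matrix (Fin 2) (Fin 2) 𝒜 →* Matrix (Fin 2 × Fin 2) (Fin 2 × Fin 2) 𝒜 where
  toFun T := Matrix.of fun x y => if x.2 = y.2 then T x.1 y.1 else 0
  map_one' := by
    ext ⟨i, j⟩ ⟨p, q⟩
    fin_cases i <;> fin_cases j <;> fin_cases p <;> fin_cases q <;> simp [Matrix.one_apply]
  map_mul' S T := by
    ext ⟨i, j⟩ ⟨p, q⟩
    fin_cases j <;> fin_cases q <;>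
      simp [Matrix.mul_apply, Fintype.sum_prod_type]

/-- The embedding `T ↦ 1 ⊗ T`. -/
def secondLeg : Matrix (Fin 2) (Fin 2) 𝒜 →* Matrix (Fin 2 × Fin 2) (Fin 2 × Fin 2) 𝒜 where
  toFun T := Matrix.of fun x y => if x.1 = y.1 then T x.2 y.2 else 0
  map_one' := by
    ext ⟨i, j⟩ ⟨p, q⟩
    fin_cases i <;> fin_cases j <;> fin_cases p <;> fin_cases q <;> simp [Matrix.one_apply]
  map_mul' S T := by
    ext ⟨i, j⟩ ⟨p, q⟩
    fin_cases i <;> fin_cases p <;>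
      simp [Matrix.mul_apply, Fintype.sum_prod_type]

lemma firstLeg_apply (T : Matrix (Fin 2) (Fin 2) 𝒜) (x y : Fin 2 × Fin 2) :
    firstLeg T x y = if x.2 = y.2 then T x.1 y.1 else 0 := rfl

lemma secondLeg_apply (T : Matrix (Fin 2) (Fin 2) 𝒜) (x y : Fin 2 × Fin 2) :
    secondLeg T x y = if x.1 = y.1 then T x.2 y.2 else 0 := rfl

lemma firstLeg_mul_secondLeg_apply (S T : Matrix (Fin 2) (Fin 2) 𝒜) (x y : Fin 2 × Fin 2) :
    (firstLeg S * secondLeg T) x y = S x.1 y.1 * T x.2 y.2 := by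
  simp [Matrix.mul_apply, Fintype.sum_prod_type, firstLeg_apply, secondLeg_apply]

lemma secondLeg_mul_firstLeg_apply (S T : Matrix (Fin 2) (Fin 2) 𝒜) (x y : Fin 2 × Fin 2) :
    (secondLeg T * firstLeg S) x y = T x.2 y.2 * S x.1 y.1 := by
  rw [Matrix.mul_apply, Fintype.sum_prod_type, Finset.sum_comm]
  simp [firstLeg_apply, secondLeg_apply]

lemma commute_firstLeg_secondLeg {S T : Matrix (Fin 2) (Fin 2) 𝒜}
    (h : ∀ i j p q, Commute (S i j) (T p q)) : Commute (firstLeg S) (secondLeg T) := by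
  ext x y
  rw [firstLeg_mul_secondLeg_apply, secondLeg_mul_firstLeg_apply, (h _ _ _ _).eq]

variable [Algebra ℂ 𝒜]

/-- A six-vertex matrix with equal corner weights. -/
def sixVertex (e p q r s : ℂ) : Matrix (Fin 2 × Fin 2) (Fin 2 × Fin 2) ℂ :=
  Matrix.of fun x y =>
    if x = y then (if x.1 = x.2 then e else if x.1 = 0 then p else s)
    else if x = y.swap then (if x.1 = 0 then q else r) else 0

/-- The twisted six-vertex `R`-matrix intertwining the cyclic `L`-operators. -/
def cyclicR (ω lam mu : ℂ) : Matrix (Fin 2 × Fin 2) (Fin 2 × Fin 2) ℂ :=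
  sixVertex (lam - ω * mu) (ω * (lam - mu)) (lam * (1 - ω)) (mu * (1 - ω)) (lam - mu)

/-- The inverse of `cyclicR ω lam mu`, up to the factor `(ω λ - μ)(λ - ω μ)`. -/
def cyclicRInv (ω lam mu : ℂ) : Matrix (Fin 2 × Fin 2) (Fin 2 × Fin 2) ℂ :=
  sixVertex (ω * lam - mu) (lam - mu) (-(lam * (1 - ω))) (-(mu * (1 - ω))) (ω * (lam - mu))

lemma cyclicRInv_mul_cyclicR (ω lam mu : ℂ) :
    cyclicRInv ω lam mu * cyclicR ω lam mu =
      ((ω * lam - mu) * (lam - ω * mu)) • (1 : Matrix (Fin 2 × Fin 2) (Fin 2 × Fin 2) ℂ) := by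
  ext ⟨i, j⟩ ⟨p, q⟩
  fin_cases i <;> fin_cases j <;> fin_cases p <;> fin_cases q <;>
    simp [Matrix.mul_apply, Fintype.sum_prod_type, cyclicR, cyclicRInv, sixVertex] <;> ring

lemma cyclicR_mul_cyclicRInv (ω lam mu : ℂ) :
    cyclicR ω lam mu * cyclicRInv ω lam mu =
      ((ω * lam - mu) * (lam - ω * mu)) • (1 : Matrix (Fin 2 × Fin 2) (Fin 2 × Fin 2) ℂ) := by
  ext ⟨i, j⟩ ⟨p, q⟩
  fin_cases i <;> fin_cases j <;> fin_cases p <;> fin_cases q <;>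
    simp [Matrix.mul_apply, Fintype.sum_prod_type, cyclicR, cyclicRInv, sixVertex] <;> ring

/-- The intertwining relation `R (S ⊗ 1) (1 ⊗ T) = (1 ⊗ T) (S ⊗ 1) R`. -/
def Intertwines (R : Matrix (Fin 2 × Fin 2) (Fin 2 × Fin 2) ℂ)
    (S T : Matrix (Fin 2) (Fin 2) 𝒜) : Prop :=
  R.map (algebraMap ℂ 𝒜) * (firstLeg S * secondLeg T) =
    secondLeg T * firstLeg S * R.map (algebraMap ℂ 𝒜)

lemma Intertwines.one (R : Matrix (Fin 2 × Fin 2) (Fin 2 × Fin 2) ℂ) :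
    Intertwines R (1 : Matrix (Fin 2) (Fin 2) 𝒜) 1 := by
  simp [Intertwines]

lemma Intertwines.mul {R : Matrix (Fin 2 × Fin 2) (Fin 2 × Fin 2) ℂ}
    {S T S' T' : Matrix (Fin 2) (Fin 2) 𝒜} (h : Intertwines R S T) (h' : Intertwines R S' T')
    (h₁ : Commute (firstLeg S') (secondLeg T)) (h₂ : Commute (firstLeg S) (secondLeg T')) :
    Intertwines R (S * S') (T * T') := by
  unfold Intertwines at *
  rw [map_mul, map_mul]
  calc _ = R.map (algebraMap ℂ 𝒜) * (firstLeg S * (firstLeg S' * secondLeg T) * secondLeg T') := by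
          simp only [mul_assoc]
    _ = (R.map (algebraMap ℂ 𝒜) * (firstLeg S * secondLeg T)) *
          (firstLeg S' * secondLeg T') := by rw [h₁.eq]; simp only [mul_assoc]
    _ = secondLeg T * firstLeg S *
          (R.map (algebraMap ℂ 𝒜) * (firstLeg S' * secondLeg T')) := by
          rw [h]; simp only [mul_assoc]
    _ = secondLeg T * (firstLeg S * secondLeg T') * firstLeg S' * R.map (algebraMap ℂ 𝒜) := by
          rw [h']; simp only [mul_assoc]
    _ = _ := by rw [h₂.eq]; simp only [mul_assoc]

lemma Intertwines.list_prod {ι : Type*} {R : Matrix (Fin 2 × Fin 2) (Fin 2 × Fin 2) ℂ}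
    {S T : ι → Matrix (Fin 2) (Fin 2) 𝒜} (h : ∀ k, Intertwines R (S k) (T k))
    (hc : ∀ k l, k ≠ l → Commute (firstLeg (S k)) (secondLeg (T l)))
    {l : List ι} (hl : l.Nodup) : Intertwines R (l.map S).prod (l.map T).prod := by
  induction l with
  | nil => simpa using Intertwines.one R
  | cons k l ih =>
    obtain ⟨hk, hl⟩ := List.nodup_cons.1 hl
    have hne : ∀ j ∈ l, j ≠ k := fun j hj hjk => hk (hjk ▸ hj)
    rw [List.map_cons, List.map_cons, List.prod_cons, List.prod_cons]
    refine (h k).mul (ih hl) ?_ ?_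
    · rw [map_list_prod, List.map_map]
      refine Commute.list_prod_left _ _ fun x hx => ?_
      obtain ⟨j, hj, rfl⟩ := List.mem_map.1 hx
      exact hc j k (hne j hj)
    · rw [map_list_prod, List.map_map]
      refine Commute.list_prod_right _ _ fun x hx => ?_
      obtain ⟨j, hj, rfl⟩ := List.mem_map.1 hx
      exact hc k j (hne j hj).symm

lemma trace_mul_map_algebraMap_comm {m : Type*} [Fintype m] (M : Matrix m m 𝒜)
    (R : Matrix m m ℂ) :
    (M * R.map (algebraMap ℂ 𝒜)).trace = (R.map (algebraMap ℂ 𝒜) * M).trace := by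
  simp only [Matrix.trace, Matrix.diag_apply, Matrix.mul_apply, Matrix.map_apply]
  rw [Finset.sum_comm]
  simp only [Algebra.commutes]

lemma Intertwines.commute_trace {ω lam mu : ℂ} {S T : Matrix (Fin 2) (Fin 2) 𝒜}
    (h : Intertwines (cyclicR ω lam mu) S T) (h₁ : ω * lam - mu ≠ 0) (h₂ : lam - ω * mu ≠ 0) :
    Commute S.trace T.trace := by
  have hST : S.trace * T.trace = (firstLeg S * secondLeg T).trace := by
    simp [Matrix.trace, firstLeg_mul_secondLeg_apply, Fintype.sum_prod_type]
    noncomm_ring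
  have hTS : T.trace * S.trace = (secondLeg T * firstLeg S).trace := by
    simp [Matrix.trace, secondLeg_mul_firstLeg_apply, Fintype.sum_prod_type]
    noncomm_ring
  have hmap (δ : ℂ) : (δ • (1 : Matrix (Fin 2 × Fin 2) (Fin 2 × Fin 2) ℂ)).map
      (algebraMap ℂ 𝒜) = δ • 1 := by
    ext x y
    simp [Matrix.one_apply, apply_ite (algebraMap ℂ 𝒜), Algebra.algebraMap_eq_smul_one]
  have key := congrArg (fun M => ((cyclicRInv ω lam mu).map (algebraMap ℂ 𝒜) * M).trace) h
  rw [← mul_assoc, ← mul_assoc _ (secondLeg T * firstLeg S), trace_mul_map_algebraMap_comm,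
    ← mul_assoc _ _ (secondLeg T * firstLeg S), ← Matrix.map_mul, ← Matrix.map_mul,
    cyclicRInv_mul_cyclicR, cyclicR_mul_cyclicRInv, hmap, smul_mul_assoc, smul_mul_assoc,
    one_mul, one_mul, Matrix.trace_smul, Matrix.trace_smul] at key
  rw [Commute, SemiconjBy, hST, hTS]
  exact smul_right_injective 𝒜 (mul_ne_zero h₁ h₂) key

/-- The cyclic `L`-operator built from elements `u`, `u'` and `v` of an algebra. -/
def cyclicL (u u' v : 𝒜) (A B C D K lam : ℂ) : Matrix (Fin 2) (Fin 2) 𝒜 :=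
  !![1 + (lam * K) • v, lam • (u' * (A • 1 - B • v));
     u * (C • 1 - D • v), (lam * A * C) • 1 + (B * D / K) • v]

lemma commute_cyclicL_apply {x u u' v : 𝒜} (hu : Commute x u) (hu' : Commute x u')
    (hv : Commute x v) (A B C D K lam : ℂ) (i j : Fin 2) :
    Commute x (cyclicL u u' v A B C D K lam i j) := by
  have h (r : ℂ) : Commute x (r • (1 : 𝒜)) := (Commute.one_right x).smul_right r
  fin_cases i <;> fin_cases j
  · exact (Commute.one_right x).add_right (hv.smul_right _)
  · exact (hu'.mul_right ((h A).sub_right (hv.smul_right B))).smul_right lam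
  · exact hu.mul_right ((h C).sub_right (hv.smul_right D))
  · exact (h _).add_right (hv.smul_right _)

set_option maxHeartbeats 1000000 in
lemma intertwines_cyclicL {ω : ℂ} (hω : ω ≠ 0) {u u' v : 𝒜} (huu' : u * u' = 1)
    (hu'u : u' * u = 1) (huv : u * v = ω • (v * u)) {A B C D K : ℂ} (hK : K ≠ 0) (lam mu : ℂ) :
    Intertwines (cyclicR ω lam mu) (cyclicL u u' v A B C D K lam)
      (cyclicL u u' v A B C D K mu) := by
  have hvu : v * u = ω⁻¹ • (u * v) := by rw [huv, smul_smul, inv_mul_cancel₀ hω, one_smul]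
  have hvu' : v * u' = ω • (u' * v) := by
    calc v * u' = u' * (u * v) * u' := by rw [← mul_assoc, hu'u, one_mul]
      _ = ω • (u' * v * (u * u')) := by
          rw [huv]
          simp only [mul_smul_comm, smul_mul_assoc, mul_assoc]
      _ = ω • (u' * v) := by rw [huu', mul_one]
  have hvu_assoc (x : 𝒜) : v * (u * x) = ω⁻¹ • (u * (v * x)) := by
    rw [← mul_assoc, hvu, smul_mul_assoc, mul_assoc]
  have hvu'_assoc (x : 𝒜) : v * (u' * x) = ω • (u' * (v * x)) := by
    rw [← mul_assoc, hvu', smul_mul_assoc, mul_assoc]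
  have huu'_assoc (x : 𝒜) : u * (u' * x) = x := by rw [← mul_assoc, huu', one_mul]
  have hu'u_assoc (x : 𝒜) : u' * (u * x) = x := by rw [← mul_assoc, hu'u, one_mul]
  ext ⟨i, j⟩ ⟨p, q⟩
  rw [Matrix.mul_apply, Matrix.mul_apply]
  simp only [firstLeg_mul_secondLeg_apply, secondLeg_mul_firstLeg_apply, Matrix.map_apply,
    Algebra.algebraMap_eq_smul_one, smul_mul_assoc, mul_smul_comm, one_mul, mul_one,
    Fintype.sum_prod_type, Fin.sum_univ_two]
  fin_cases i <;> fin_cases j <;> fin_cases p <;> fin_cases q <;>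
    simp [cyclicR, sixVertex, cyclicL, mul_add, add_mul, mul_sub, sub_mul, mul_assoc,
      hvu, hvu', huu', hu'u, hvu_assoc, hvu'_assoc, huu'_assoc, hu'u_assoc, -smul_add] <;>
    match_scalars <;> field_simp <;> ring

end RMatrix

/-- Families of operators preserving continuous families of vectors. -/
def ContinuousFamily {N n : ℕ} (F : ℂ → Module.End ℂ (BBSV N n)) : Prop :=
  ∀ (g : ℂ → ℂ) (f : ℂ → BBSV N n), Continuous g → Continuous f →
    Continuous fun z => F (g z) (f z)

namespace ContinuousFamily

variable {N n : ℕ} {F G : ℂ → Module.End ℂ (BBSV N n)}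

lemma add (hF : ContinuousFamily F) (hG : ContinuousFamily G) :
    ContinuousFamily fun z => F z + G z :=
  fun g f hg hf => (hF g f hg hf).add (hG g f hg hf)

lemma sub (hF : ContinuousFamily F) (hG : ContinuousFamily G) :
    ContinuousFamily fun z => F z - G z :=
  fun g f hg hf => (hF g f hg hf).sub (hG g f hg hf)

lemma mul (hF : ContinuousFamily F) (hG : ContinuousFamily G) :
    ContinuousFamily fun z => F z * G z :=
  fun g f hg hf => hF g _ hg (hG g f hg hf)

lemma smul {r : ℂ → ℂ} (hr : Continuous r) (hF : ContinuousFamily F) :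
    ContinuousFamily fun z => r z • F z :=
  fun g f hg hf => (hr.comp hg).smul (hF g f hg hf)

lemma one : ContinuousFamily fun _ => (1 : Module.End ℂ (BBSV N n)) :=
  fun _ _ _ hf => hf

lemma zero : ContinuousFamily fun _ => (0 : Module.End ℂ (BBSV N n)) :=
  fun _ _ _ _ => continuous_const

end ContinuousFamily

section Sites

variable {N n : ℕ}

lemma continuousFamily_Vop (k : Fin n) : ContinuousFamily fun _ => Vop N k :=
  fun _ _ _ hf => continuous_pi fun γ =>
    (continuous_apply (fun j => γ j - if j = k then 1 else 0)).comp hf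

lemma continuousFamily_Uop (ω : ℂ) (k : Fin n) : ContinuousFamily fun _ => Uop N ω k :=
  fun _ _ _ hf => continuous_pi fun γ => continuous_const.mul ((continuous_apply γ).comp hf)

lemma continuousFamily_Uinv (ω : ℂ) (k : Fin n) : ContinuousFamily fun _ => Uinv N ω k :=
  fun _ _ _ hf => continuous_pi fun γ => continuous_const.mul ((continuous_apply γ).comp hf)

lemma continuousFamily_Lop (ω A B C D K : ℂ) (k : Fin n) (i j : Fin 2) :
    ContinuousFamily fun z => Lop N ω A B C D K k z i j := by
  have hc (P Q : ℂ) : ContinuousFamily fun _ : ℂ =>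
      P • (1 : Module.End ℂ (BBSV N n)) - Q • Vop N k :=
    (ContinuousFamily.one.smul continuous_const).sub
      ((continuousFamily_Vop k).smul continuous_const)
  fin_cases i <;> fin_cases j
  · exact ContinuousFamily.one.add ((continuousFamily_Vop k).smul (by fun_prop))
  · exact ((continuousFamily_Uinv ω k).mul (hc A B)).smul continuous_id
  · exact (continuousFamily_Uop ω k).mul (hc C D)
  · exact (ContinuousFamily.one.smul (by fun_prop)).add
      ((continuousFamily_Vop k).smul continuous_const)

lemma continuousFamily_list_prod {ι : Type*}
    {L : ι → ℂ → Matrix (Fin 2) (Fin 2) (Module.End ℂ (BBSV N n))}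
    (hL : ∀ k i j, ContinuousFamily fun z => L k z i j) (l : List ι) (i j : Fin 2) :
    ContinuousFamily fun z => (l.map fun k => L k z).prod i j := by
  induction l generalizing i j with
  | nil =>
    by_cases h : i = j
    · simpa [Matrix.one_apply, h] using ContinuousFamily.one
    · simpa [Matrix.one_apply, h] using ContinuousFamily.zero
  | cons k l ih =>
    simp only [List.map_cons, List.prod_cons, Matrix.mul_apply, Fin.sum_univ_two]
    exact ((hL k i 0).mul (ih 0 j)).add ((hL k i 1).mul (ih 1 j))

lemma continuousFamily_trace_Tmat (ω : ℂ) (a b c d κ : ℕ → ℂ) :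
    ContinuousFamily fun z => (Tmat N ω a b c d κ n z).trace := by
  simp only [Matrix.trace, Fin.sum_univ_two, Matrix.diag_apply]
  have h := continuousFamily_list_prod (N := N) (n := n)
    (L := fun k : Fin n => Lop N ω (a k.val) (b k.val) (c k.val) (d k.val) (κ k.val) k)
    (fun k => continuousFamily_Lop ω (a k.val) (b k.val) (c k.val) (d k.val) (κ k.val) k)
    (List.finRange n)
  exact (h 0 0).add (h 1 1)

lemma pow_val_add [NeZero N] {ω : ℂ} (hω : ω ^ N = 1) (x y : ZMod N) :
    ω ^ (x + y).val = ω ^ x.val * ω ^ y.val := by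
  rw [ZMod.val_add, ← pow_eq_pow_mod _ hω, pow_add]

lemma Uop_mul_Uinv [NeZero N] {ω : ℂ} (hω : ω ^ N = 1) (k : Fin n) :
    Uop N ω k * Uinv N ω k = 1 := by
  refine LinearMap.ext fun f => funext fun γ => ?_
  change ω ^ (γ k).val * (ω ^ (-γ k).val * f γ) = f γ
  rw [← mul_assoc, ← pow_val_add hω, add_neg_cancel, ZMod.val_zero, pow_zero, one_mul]

lemma Uinv_mul_Uop [NeZero N] {ω : ℂ} (hω : ω ^ N = 1) (k : Fin n) :
    Uinv N ω k * Uop N ω k = 1 := by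
  refine LinearMap.ext fun f => funext fun γ => ?_
  change ω ^ (-γ k).val * (ω ^ (γ k).val * f γ) = f γ
  rw [← mul_assoc, ← pow_val_add hω, neg_add_cancel, ZMod.val_zero, pow_zero, one_mul]

lemma Uop_mul_Vop (hN : 2 ≤ N) {ω : ℂ} (hω : ω ^ N = 1) (k : Fin n) :
    Uop N ω k * Vop N k = ω • (Vop N k * Uop N ω k) := by
  have : NeZero N := ⟨by omega⟩
  have : Fact (1 < N) := ⟨hN⟩
  refine LinearMap.ext fun f => funext fun γ => ?_
  change ω ^ (γ k).val * f (fun j => γ j - if j = k then 1 else 0) =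
    ω * (ω ^ (γ k - if k = k then 1 else 0).val * f (fun j => γ j - if j = k then 1 else 0))
  have h := pow_val_add hω (γ k - 1) 1
  rw [sub_add_cancel, ZMod.val_one, pow_one] at h
  rw [if_pos rfl, h]
  ring

lemma commute_Uop_Uop (ω : ℂ) (k l : Fin n) : Commute (Uop N ω k) (Uop N ω l) :=
  LinearMap.ext fun _ => funext fun _ => mul_left_comm _ _ _

lemma commute_Uop_Uinv (ω : ℂ) (k l : Fin n) : Commute (Uop N ω k) (Uinv N ω l) :=
  LinearMap.ext fun _ => funext fun _ => mul_left_comm _ _ _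

lemma commute_Uinv_Uinv (ω : ℂ) (k l : Fin n) : Commute (Uinv N ω k) (Uinv N ω l) :=
  LinearMap.ext fun _ => funext fun _ => mul_left_comm _ _ _

lemma commute_Vop_Vop (k l : Fin n) : Commute (Vop N k) (Vop N l) :=
  LinearMap.ext fun f => funext fun _ => congrArg f (funext fun _ => sub_right_comm _ _ _)

lemma commute_Uop_Vop (ω : ℂ) {k l : Fin n} (h : k ≠ l) : Commute (Uop N ω k) (Vop N l) := by
  refine LinearMap.ext fun f => funext fun γ => ?_
  change ω ^ (γ k).val * f (fun j => γ j - if j = l then 1 else 0) =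
    ω ^ (γ k - if k = l then 1 else 0).val * f (fun j => γ j - if j = l then 1 else 0)
  rw [if_neg h, sub_zero]

lemma commute_Uinv_Vop (ω : ℂ) {k l : Fin n} (h : k ≠ l) : Commute (Uinv N ω k) (Vop N l) := by
  refine LinearMap.ext fun f => funext fun γ => ?_
  change ω ^ (-γ k).val * f (fun j => γ j - if j = l then 1 else 0) =
    ω ^ (-(γ k - if k = l then 1 else 0)).val * f (fun j => γ j - if j = l then 1 else 0)
  rw [if_neg h, sub_zero]

lemma Lop_eq_cyclicL (ω A B C D K : ℂ) (k : Fin n) (lam : ℂ) :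
    Lop N ω A B C D K k lam =
      cyclicL (Uop N ω k) (Uinv N ω k) (Vop N k) A B C D K lam := rfl

lemma commute_Lop_apply (ω : ℂ) {k l : Fin n} (h : k ≠ l)
    (A B C D K lam A' B' C' D' K' mu : ℂ) (i j p q : Fin 2) :
    Commute (Lop N ω A B C D K k lam i j) (Lop N ω A' B' C' D' K' l mu p q) := by
  rw [Lop_eq_cyclicL, Lop_eq_cyclicL]
  refine commute_cyclicL_apply (Commute.symm ?_) (Commute.symm ?_) (Commute.symm ?_) ..
  · exact commute_cyclicL_apply (commute_Uop_Uop ω l k) (commute_Uop_Uinv ω l k)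
      (commute_Uop_Vop ω h.symm) ..
  · exact commute_cyclicL_apply (commute_Uop_Uinv ω k l).symm (commute_Uinv_Uinv ω l k)
      (commute_Uinv_Vop ω h.symm) ..
  · exact commute_cyclicL_apply (commute_Uop_Vop ω h).symm (commute_Uinv_Vop ω h).symm
      (commute_Vop_Vop l k) ..

lemma intertwines_Tmat (hN : 2 ≤ N) {ω : ℂ} (hω : ω ^ N = 1) {a b c d κ : ℕ → ℂ}
    (hκ : ∀ k < n, κ k ≠ 0) (lam mu : ℂ) :
    Intertwines (cyclicR ω lam mu) (Tmat N ω a b c d κ n lam) (Tmat N ω a b c d κ n mu) := by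
  have : NeZero N := ⟨by omega⟩
  have hω₀ : ω ≠ 0 := by
    rintro rfl
    simp [NeZero.ne N] at hω
  refine Intertwines.list_prod (fun k => ?_) (fun k l hkl => ?_) (List.nodup_finRange n)
  · exact intertwines_cyclicL hω₀ (Uop_mul_Uinv hω k) (Uinv_mul_Uop hω k)
      (Uop_mul_Vop hN hω k) (hκ k k.isLt) lam mu
  · exact commute_firstLeg_secondLeg (commute_Lop_apply ω hkl _ _ _ _ _ _ _ _ _ _ _ _)

lemma commute_trace_Tmat (hN : 2 ≤ N) {ω : ℂ} (hω : ω ^ N = 1) {a b c d κ : ℕ → ℂ}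
    (hκ : ∀ k < n, κ k ≠ 0) (lam mu : ℂ) :
    Commute (Tmat N ω a b c d κ n lam).trace (Tmat N ω a b c d κ n mu).trace := by
  have hω₀ : ω ≠ 0 := by
    rintro rfl
    simp [show N ≠ 0 by omega] at hω
  have hdense : Dense ({ω * lam, lam / ω}ᶜ : Set ℂ) := (Set.toFinite _).countable.dense_compl ℂ
  have hcont := continuousFamily_trace_Tmat (N := N) (n := n) ω a b c d κ
  have hconst : ContinuousFamily fun _ => (Tmat N ω a b c d κ n lam).trace :=
    fun _ f _ hf => hcont (fun _ => lam) f continuous_const hf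
  refine LinearMap.ext fun f => ?_
  refine congrFun (Continuous.ext_on hdense ((hconst.mul hcont) id _ continuous_id continuous_const)
    ((hcont.mul hconst) id _ continuous_id continuous_const) fun z hz => ?_) mu
  simp only [Set.mem_compl_iff, Set.mem_insert_iff, Set.mem_singleton_iff, not_or] at hz
  refine LinearMap.congr_fun
    ((intertwines_Tmat hN hω hκ lam z).commute_trace (fun h => hz.1 ?_) (fun h => hz.2 ?_)).eq f
  · exact (sub_eq_zero.1 h).symm
  · rw [eq_div_iff hω₀, mul_comm]
    exact (sub_eq_zero.1 h).symm

end Sites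

/-- The transfer matrices of the Baxter–Bazhanov–Stroganov model commute at different
values of the spectral parameter: `t_n(λ) ∘ t_n(μ) = t_n(μ) ∘ t_n(λ)` on `V^(n)`,
where `t_n(λ) = A_n(λ) + D_n(λ)`. -/
theorem bbs_transfer_matrices_commute
    (N : ℕ) (hN : 2 ≤ N) (n : ℕ) (hn : 1 ≤ n)
    (ω : ℂ) (hω : ω = Complex.exp (2 * Real.pi * Complex.I / N))
    (a b c d κ : ℕ → ℂ) (hκ : ∀ k < n, κ k ≠ 0)
    (lam mu : ℂ) :
    (Tmat N ω a b c d κ n lam 0 0 + Tmat N ω a b c d κ n lam 1 1) *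
        (Tmat N ω a b c d κ n mu 0 0 + Tmat N ω a b c d κ n mu 1 1) =
      (Tmat N ω a b c d κ n mu 0 0 + Tmat N ω a b c d κ n mu 1 1) *
        (Tmat N ω a b c d κ n lam 0 0 + Tmat N ω a b c d κ n lam 1 1) := by
  have hω' : ω ^ N = 1 := by
    rw [hω]
    exact (Complex.isPrimitiveRoot_exp N (by omega)).pow_eq_one
  simpa only [Matrix.trace, Fin.sum_univ_two, Matrix.diag_apply] using
    (commute_trace_Tmat hN hω' hκ lam mu).eq
end
end

section
/- Ising factorization of the N = 2 BBS transfer matrix: let N = 2 (so ω = −1), take homogeneous parameters a_k = a, b_k = b, c_k = c, d_k = d, κ_k = κ with a ≠ 0, κ ≠ 0 and d = bc/a, and set λ₀ = b/(aκ). Then the transfer matrix factorizes as t_n(λ₀) = ( ∏_{k=1}^{n} (1 + (b/a)·v_k) ) ∘ ( ∏_{k=1}^{n} (1 + (bc/κ)·u_{k−1}u_k) ) as operators on V^(n), where u_0 := u_n (periodic boundary conditions); the factors within each of the two products commute pairwise, so their order is immaterial. -/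
open scoped BigOperators

noncomputable section

/-- The `n`-site quantum space for `N = 2`: functions `(Fin n → ZMod 2) → ℂ`. -/
abbrev BBSV2 (n : ℕ) : Type := (Fin n → ZMod 2) → ℂ

/-- Weyl operator `u_k` for `N = 2` (with `ω = −1`): `u_k|γ⟩ = (−1)^{γ_k}|γ⟩`. -/
def Uop2 {n : ℕ} (k : Fin n) : Module.End ℂ (BBSV2 n) where
  toFun f := fun γ => (-1 : ℂ) ^ (γ k).val * f γ
  map_add' f g := by funext γ; simp [mul_add]
  map_smul' r f := by
    funext γ
    simp only [Pi.smul_apply, smul_eq_mul, RingHom.id_apply]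
    ring

/-- Weyl operator `v_k` for `N = 2`: `v_k|γ⟩ = |γ + e_k⟩`. -/
def Vop2 {n : ℕ} (k : Fin n) : Module.End ℂ (BBSV2 n) where
  toFun f := fun γ => f (fun j => γ j - if j = k then 1 else 0)
  map_add' f g := rfl
  map_smul' r f := rfl

/-- The cyclic L-operator at site `k` for the homogeneous `N = 2` model (where
`u_k⁻¹ = u_k`). -/
def Lop2 {n : ℕ} (a b c d κ : ℂ) (k : Fin n) (lam : ℂ) :
    Matrix (Fin 2) (Fin 2) (Module.End ℂ (BBSV2 n)) :=
  !![1 + (lam * κ) • Vop2 k,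
     lam • (Uop2 k * (a • (1 : Module.End ℂ (BBSV2 n)) - b • Vop2 k));
     Uop2 k * (c • (1 : Module.End ℂ (BBSV2 n)) - d • Vop2 k),
     (lam * a * c) • (1 : Module.End ℂ (BBSV2 n)) + (b * d / κ) • Vop2 k]

/-- The monodromy matrix `T_n(λ) = L_1(λ) ⋯ L_n(λ)` of the homogeneous `N = 2` chain. -/
def Tmat2 (n : ℕ) (a b c d κ : ℂ) (lam : ℂ) :
    Matrix (Fin 2) (Fin 2) (Module.End ℂ (BBSV2 n)) :=
  ((List.finRange n).map (fun k => Lop2 a b c d κ k lam)).prod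

/-- The entries of a product of rank-one matrices `w_k · (1, q u_k)ᵀ (1, p u_k)`, when every `w_i`
commutes with every `u_j`, `j ≠ i`. -/
theorem prod_rankOne_apply {R : Type*} [Ring R] [Algebra ℂ R] (p q : ℂ) (m : ℕ)
    (w u : Fin (m + 1) → R) (hwu : ∀ i j, i ≠ j → Commute (w i) (u j)) (i j : Fin 2) :
    (((List.finRange (m + 1)).map (fun k => Matrix.of fun r s : Fin 2 =>
        w k * (![1, q • u k] r * ![1, p • u k] s))).prod : Matrix (Fin 2) (Fin 2) R) i j =
      ((List.finRange (m + 1)).map w).prod *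
        (![1, q • u 0] i *
          ((List.finRange m).map
            (fun k => 1 + (p * q) • (u k.castSucc * u k.succ))).prod *
          ![1, p • u (Fin.last m)] j) := by
  induction m generalizing i with
  | zero => simp [List.finRange_succ]
  | succ m ih =>
    rw [List.finRange_succ, List.map_cons, List.prod_cons, List.map_map, Matrix.mul_apply]
    have key := ih (fun k => w k.succ) (fun k => u k.succ)
      (fun a b hab => hwu _ _ (fun h => hab (Fin.succ_injective _ h)))
    simp only [Function.comp_def, Fin.sum_univ_two, key, List.map_cons, List.prod_cons,
      List.map_map]
    have hW (x : R) (hx : ∀ k : Fin (m + 1), Commute (w k.succ) x) :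
        Commute ((List.finRange (m + 1)).map fun k => w k.succ).prod x := by
      refine Commute.list_prod_left _ _ fun y hy => ?_
      obtain ⟨k, -, rfl⟩ := List.mem_map.1 hy
      exact hx k
    generalize ((List.finRange (m + 1)).map fun k => w k.succ).prod = W at hW ⊢
    rw [List.finRange_succ (n := m), List.map_cons, List.prod_cons, List.map_map]
    simp only [Function.comp_def, Fin.castSucc_zero, Fin.succ_castSucc, Fin.succ_last,
      Matrix.of_apply, Matrix.cons_val_zero, Matrix.cons_val_one]
    generalize ((List.finRange m).map fun k =>
      1 + (p * q) • (u k.succ.castSucc * u k.succ.succ)).prod = P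
    have hu : Commute W (u 0) := hW _ fun k => hwu _ _ (Fin.succ_ne_zero k)
    have hc : Commute W (![1, q • u 0] i) := by
      fin_cases i
      · exact Commute.one_right W
      · exact hu.smul_right q
    generalize ![1, q • u 0] i = x at hc ⊢
    generalize ![1, p • u (Fin.last (m + 1))] j = y
    have h1 (z : R) : x * (W * z) = W * (x * z) := by
      rw [← mul_assoc, ← hc.eq, mul_assoc]
    have h2 (z : R) : u 0 * (W * z) = W * (u 0 * z) := by
      rw [← mul_assoc, ← hu.eq, mul_assoc]
    simp only [mul_assoc, one_mul, mul_add, add_mul, smul_mul_assoc, mul_smul_comm, smul_smul,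
      h1, h2, mul_comm q p]

theorem Uop2_mul_self {n : ℕ} (k : Fin n) : Uop2 k * Uop2 k = 1 := by
  ext f γ
  simp [Uop2, ← mul_assoc, ← mul_pow]

theorem commute_Uop2 {n : ℕ} (i j : Fin n) : Commute (Uop2 i) (Uop2 j) := by
  refine LinearMap.ext fun f => funext fun γ => ?_
  simp only [Uop2, Module.End.mul_apply, LinearMap.coe_mk, AddHom.coe_mk]
  ring

theorem commute_Vop2_Uop2 {n : ℕ} {i j : Fin n} (h : i ≠ j) : Commute (Vop2 i) (Uop2 j) := by
  refine LinearMap.ext fun f => funext fun γ => ?_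
  simp [Uop2, Vop2, h.symm]

theorem Uop2_mul_Vop2 {n : ℕ} (k : Fin n) : Uop2 k * Vop2 k = -(Vop2 k * Uop2 k) := by
  refine LinearMap.ext fun f => funext fun γ => ?_
  have h : ∀ x : ZMod 2, (-1 : ℂ) ^ (x - 1).val = -(-1) ^ x.val := by
    intro x
    have hx : ∀ x : ZMod 2,
        (x.val = 0 ∧ (x - 1).val = 1) ∨ (x.val = 1 ∧ (x - 1).val = 0) := by decide
    rcases hx x with ⟨h0, h1⟩ | ⟨h0, h1⟩ <;> simp [h0, h1]
  simp [Uop2, Vop2, h]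

/-- At `d = bc/a` and `λ₀ = b/(aκ)` the `L`-operator has rank one up to a left factor. -/
theorem Lop2_eq_rankOne {n : ℕ} (a b c d κ : ℂ) (ha : a ≠ 0) (hκ : κ ≠ 0)
    (hd : d = b * c / a) (k : Fin n) :
    Lop2 a b c d κ k (b / (a * κ)) = Matrix.of fun r s : Fin 2 =>
      (1 + (b / a) • Vop2 k) * (![1, c • Uop2 k] r * ![1, (b / κ) • Uop2 k] s) := by
  subst hd
  ext1 r s
  fin_cases r <;> fin_cases s <;>
    simp [Lop2, mul_sub, add_mul, Uop2_mul_Vop2, Uop2_mul_self, smul_smul, smul_add]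
  all_goals match_scalars <;> field_simp

/-- Ising factorization of the `N = 2` BBS transfer matrix: for homogeneous parameters
with `d = bc/a` and at `λ₀ = b/(aκ)`, the transfer matrix factorizes as
`t_n(λ₀) = (∏_k (1 + (b/a)v_k)) ∘ (∏_k (1 + (bc/κ)u_{k−1}u_k))`, with `u_0 := u_n`. -/
theorem bbs_ising_factorization
    (n : ℕ) (hn : 1 ≤ n)
    (a b c d κ : ℂ) (ha : a ≠ 0) (hκ : κ ≠ 0) (hd : d = b * c / a) :
    Tmat2 n a b c d κ (b / (a * κ)) 0 0 + Tmat2 n a b c d κ (b / (a * κ)) 1 1 =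
      (((List.finRange n).map
          (fun k => 1 + (b / a) • Vop2 k)).prod : Module.End ℂ (BBSV2 n)) *
        ((List.finRange n).map
          (fun k => 1 + (b * c / κ) •
            (Uop2 (k - ⟨1 % n, Nat.mod_lt _ (by omega)⟩) * Uop2 k))).prod := by
  obtain ⟨m, rfl⟩ : ∃ m, n = m + 1 := ⟨n - 1, by omega⟩
  have hlast : (0 : Fin (m + 1)) - ⟨1 % (m + 1), Nat.mod_lt _ (by omega)⟩ = Fin.last m := by
    rw [sub_eq_iff_eq_add]
    ext
    simp [Fin.val_add]
  have hsucc (k : Fin m) :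
      k.succ - ⟨1 % (m + 1), Nat.mod_lt _ (by omega)⟩ = k.castSucc := by
    rw [sub_eq_iff_eq_add]
    ext
    simp [Fin.val_add, Nat.mod_eq_of_lt]
  have hentry := prod_rankOne_apply (b / κ) c m (fun k => 1 + (b / a) • Vop2 k) Uop2
    (fun i j hij => (Commute.one_left _).add_left ((commute_Vop2_Uop2 hij).smul_left _))
  simp only [Tmat2, Lop2_eq_rankOne a b c d κ ha hκ hd, hentry]
  rw [← mul_add]
  congr 1
  rw [List.finRange_succ, List.map_cons, List.prod_cons, List.map_map]
  simp only [Function.comp_def, hlast, hsucc, Matrix.cons_val_zero, Matrix.cons_val_one]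
  rw [div_mul_eq_mul_div]
  set P := ((List.finRange m).map fun k : Fin m =>
    1 + (b * c / κ) • (Uop2 k.castSucc * Uop2 k.succ)).prod
  have hcomm (j : Fin (m + 1)) : Commute P (Uop2 j) := by
    refine Commute.list_prod_left _ _ fun x hx => ?_
    obtain ⟨k, -, rfl⟩ := List.mem_map.1 hx
    exact (Commute.one_left _).add_left
      (((commute_Uop2 _ _).mul_left (commute_Uop2 _ _)).smul_left _)
  simp only [add_mul, one_mul, mul_one, mul_smul_comm, smul_mul_assoc, smul_smul, mul_assoc]
  rw [(hcomm (Fin.last m)).eq, ← mul_assoc, ← mul_assoc, (commute_Uop2 0 (Fin.last m)).eq, div_mul_eq_mul_div]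
end
end
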